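/- arXiv:1901.09818 — 7 statements merged into one kernel-verified Lean document; each statement's English description precedes it below -/
import Mathlib

section
/- For every natural number N there exists a base-3/2 digit string d whose value equals N; that is, every nonnegative integer admits a finite base-3/2 representation using only the digits 0, 1, 2. -/
/-- The value of a base-3/2 digit string (a finitely supported `ℕ → ℕ`). -/
def val32 (d : ℕ →₀ ℕ) : ℚ := d.sum fun i c => (c : ℚ) * (3 / 2 : ℚ) ^ i

theorem val32_single (i c : ℕ) : val32 (Finsupp.single i c) = c * (3 / 2 : ℚ) ^ i := by
  simp [val32]

theorem val32_add (d e : ℕ →₀ ℕ) : val32 (d + e) = val32 d + val32 e :=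
  Finsupp.sum_add_index' (by simp) (by intros; push_cast; ring)

theorem val32_mapDomain_succ (d : ℕ →₀ ℕ) :
    val32 (d.mapDomain Nat.succ) = 3 / 2 * val32 d := by
  rw [val32, Finsupp.sum_mapDomain_index (by simp) (by intros; push_cast; ring), val32,
    Finsupp.mul_sum]
  exact Finsupp.sum_congr fun i _ => by rw [pow_succ]; ring

/-- Every nonnegative integer admits a finite base-3/2 representation
using only the digits 0, 1, 2. -/
theorem every_nat_has_base32_representation (N : ℕ) :
    ∃ d : ℕ →₀ ℕ, (∀ i, d i ≤ 2) ∧ val32 d = N := by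
  induction N using Nat.strong_induction_on with
  | _ N ih =>
    by_cases hN : N < 3
    · refine ⟨Finsupp.single 0 N, fun i => ?_, by simp [val32_single]⟩
      rw [Finsupp.single_apply]
      split_ifs <;> omega
    · obtain ⟨d, hd, hv⟩ := ih (2 * (N / 3)) (by omega)
      refine ⟨Finsupp.single 0 (N % 3) + d.mapDomain Nat.succ, fun i => ?_, ?_⟩
      · cases i with
        | zero =>
          rw [Finsupp.add_apply, Finsupp.mapDomain_of_notMem_range d 0 (by simp)]
          simp only [Finsupp.single_eq_same]
          omega
        | succ i =>
          have h : d.mapDomain Nat.succ (i + 1) = d i :=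
            Finsupp.mapDomain_apply Nat.succ_injective d i
          simpa [h] using hd i
      · have h : ((N % 3 + 3 * (N / 3) : ℕ) : ℚ) = N := by rw [Nat.mod_add_div]
        rw [val32_add, val32_single, val32_mapDomain_succ, hv, ← h]
        push_cast
        ring
end

section
/- If a and b are base-1.5 digit strings with equal values, then a = b. In other words, no two distinct finite base-1.5 digit strings represent the same number. -/
/-- The value of a base-1.5 digit string (a finitely supported `ℕ → ℚ`
whose digits lie in `{0, 1/2, 1}`). -/
def val15 (a : ℕ →₀ ℚ) : ℚ := a.sum fun i c => c * (3 / 2 : ℚ) ^ i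

/-- `a` is a base-1.5 digit string: each digit is 0, H = 1/2, or 1. -/
def IsBase15 (a : ℕ →₀ ℚ) : Prop := ∀ i, a i = 0 ∨ a i = 1 / 2 ∨ a i = 1

/-- Multiplying by `2 ^ n` clears the denominators of an integer combination of the first `n`
powers of `3 / 2`. -/
theorem exists_int_two_pow_mul_sum (n : ℕ) (d : ℕ → ℤ) :
    ∃ m : ℤ, (2 : ℚ) ^ n * ∑ i ∈ Finset.range n, (d i : ℚ) * (3 / 2) ^ i = m := by
  induction n with
  | zero => exact ⟨0, by simp⟩
  | succ n ih =>
    obtain ⟨m, hm⟩ := ih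
    refine ⟨2 * m + 2 * d n * 3 ^ n, ?_⟩
    have hpow : (2 : ℚ) ^ n * (3 / 2) ^ n = 3 ^ n := by rw [← mul_pow]; norm_num
    rw [Finset.sum_range_succ]
    push_cast
    rw [← hm, ← hpow]
    ring

/-- A vanishing combination of powers of `3 / 2` with integer coefficients of absolute value
less than `3` is trivial. -/
theorem eq_zero_of_sum_three_halves_pow_eq_zero (n : ℕ) (d : ℕ → ℤ) (hd : ∀ i, |d i| < 3)
    (h : ∑ i ∈ Finset.range n, (d i : ℚ) * (3 / 2) ^ i = 0) : ∀ i < n, d i = 0 := by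
  induction n generalizing d with
  | zero => simp
  | succ n ih =>
    obtain ⟨m, hm⟩ := exists_int_two_pow_mul_sum n fun i => d (i + 1)
    have hsplit : (d 0 : ℚ) +
        3 / 2 * ∑ i ∈ Finset.range n, (d (i + 1) : ℚ) * (3 / 2) ^ i = 0 := by
      rw [← h, Finset.sum_range_succ', Finset.mul_sum, pow_zero, mul_one, add_comm]
      congr 1
      exact Finset.sum_congr rfl fun i _ => by ring
    have hint : (2 : ℤ) ^ (n + 1) * d 0 = 3 * -m := by
      have : (2 : ℚ) ^ (n + 1) * d 0 = 3 * -m := by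
        rw [← hm]
        linear_combination (2 : ℚ) ^ (n + 1) * hsplit
      exact_mod_cast this
    have hcop : IsCoprime (3 : ℤ) (2 ^ (n + 1)) := IsCoprime.pow_right ⟨1, -1, by norm_num⟩
    have h0 : d 0 = 0 :=
      Int.eq_zero_of_abs_lt_dvd (hcop.dvd_of_dvd_mul_left ⟨_, hint⟩) (hd 0)
    have htail := ih (fun i => d (i + 1)) (fun i => hd _) (by simpa [h0] using hsplit)
    rintro (_ | i) hi
    · exact h0
    · exact htail i (by omega)

/-- The digits of a base-1.5 string are halves of integers between `0` and `2`. -/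
theorem IsBase15.exists_int {a : ℕ →₀ ℚ} (ha : IsBase15 a) (i : ℕ) :
    ∃ k : ℤ, 0 ≤ k ∧ k ≤ 2 ∧ (k : ℚ) = 2 * a i := by
  rcases ha i with h | h | h
  · exact ⟨0, by simp [h]⟩
  · exact ⟨1, by simp [h]⟩
  · exact ⟨2, by simp [h]⟩

/-- The value of a string is the sum over any initial range containing its support. -/
theorem val15_eq_sum_range {a : ℕ →₀ ℚ} {n : ℕ} (hn : a.support ⊆ Finset.range n) :
    val15 a = ∑ i ∈ Finset.range n, a i * (3 / 2 : ℚ) ^ i :=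
  Finsupp.sum_of_support_subset a hn _ fun _ _ => zero_mul _

/-- No two distinct finite base-1.5 digit strings represent the same number. -/
theorem base15_representation_unique (a b : ℕ →₀ ℚ)
    (ha : IsBase15 a) (hb : IsBase15 b) (h : val15 a = val15 b) : a = b := by
  choose f hf0 hf2 hf using ha.exists_int
  choose g hg0 hg2 hg using hb.exists_int
  obtain ⟨n, hn⟩ := (a.support ∪ b.support).exists_nat_subset_range
  have hsub := Finset.union_subset_iff.1 hn
  rw [val15_eq_sum_range hsub.1, val15_eq_sum_range hsub.2] at h
  have hzero := eq_zero_of_sum_three_halves_pow_eq_zero n (fun i => f i - g i)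
    (fun i => abs_lt.2 ⟨by linarith [hf0 i, hg2 i], by linarith [hf2 i, hg0 i]⟩) (by
      have hterm : ∀ i, ((f i - g i : ℤ) : ℚ) * (3 / 2) ^ i =
          2 * (a i * (3 / 2) ^ i - b i * (3 / 2) ^ i) := fun i => by
        push_cast
        rw [hf, hg]
        ring
      simp_rw [hterm]
      rw [← Finset.mul_sum, Finset.sum_sub_distrib, h, sub_self, mul_zero])
  ext i
  by_cases hi : i < n
  · have hfg : (f i : ℚ) = g i := by exact_mod_cast sub_eq_zero.1 (hzero i hi)
    linarith [hf i, hg i]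
  · have hmem : i ∉ Finset.range n := by simpa using hi
    rw [Finsupp.notMem_support_iff.1 fun hs => hmem (hsub.1 hs),
      Finsupp.notMem_support_iff.1 fun hs => hmem (hsub.2 hs)]
end

section
/- If d is a base-3/2 digit string whose value v(d) is an integer N with N ≥ 2, and k is the largest index with d k ≠ 0, then d k = 2; that is, the base-3/2 representation of every integer greater than or equal to 2 has leading digit 2. -/
theorem val32_eq_sum_range (d : ℕ →₀ ℕ) (k : ℕ) (hmax : ∀ i, k < i → d i = 0) :
    val32 d = ∑ i ∈ Finset.range (k + 1), (d i : ℚ) * (3 / 2 : ℚ) ^ i := by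
  refine Finsupp.sum_of_support_subset d (fun i hi => ?_) _ (by simp)
  by_contra h
  exact (Finsupp.mem_support_iff.mp hi) (hmax i (by simpa using h))

/-- Clearing denominators in the value of a digit string. -/
theorem two_pow_mul_val32 (d : ℕ →₀ ℕ) (k : ℕ) (hmax : ∀ i, k < i → d i = 0) :
    2 ^ k * val32 d =
      ((∑ i ∈ Finset.range k, d i * 3 ^ i * 2 ^ (k - i) + d k * 3 ^ k : ℤ) : ℚ) := by
  have h (i : ℕ) (hi : i ≤ k) :
      (2 : ℚ) ^ k * (d i * (3 / 2 : ℚ) ^ i) = d i * 3 ^ i * 2 ^ (k - i) := by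
    obtain ⟨j, rfl⟩ := Nat.exists_eq_add_of_le hi
    rw [Nat.add_sub_cancel_left, div_pow, pow_add]
    field_simp
  rw [val32_eq_sum_range d k hmax, Finset.mul_sum, Finset.sum_range_succ, h k le_rfl,
    Finset.sum_congr rfl fun i hi => h i (Finset.mem_range.mp hi).le]
  push_cast
  simp

/-- The base-3/2 representation of every integer `N ≥ 2` has leading digit 2. -/
theorem base32_leading_digit_two (d : ℕ →₀ ℕ) (hd : ∀ i, d i ≤ 2)
    (N : ℤ) (hN : 2 ≤ N) (hval : val32 d = N)
    (k : ℕ) (hk : d k ≠ 0) (hmax : ∀ i, k < i → d i = 0) :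
    d k = 2 := by
  have key := two_pow_mul_val32 d k hmax
  rw [hval] at key
  have hZ : 2 ^ k * N =
      ∑ i ∈ Finset.range k, (d i : ℤ) * 3 ^ i * 2 ^ (k - i) + d k * 3 ^ k := by
    exact_mod_cast key
  have hdk := hd k
  rcases Nat.eq_zero_or_pos k with rfl | hpos
  · simp at hZ
    omega
  · have hsum : (2 : ℤ) ∣ ∑ i ∈ Finset.range k, (d i : ℤ) * 3 ^ i * 2 ^ (k - i) :=
      Finset.dvd_sum fun i hi => Dvd.dvd.mul_left
        (dvd_pow_self 2 (Nat.sub_pos_of_lt (Finset.mem_range.mp hi)).ne') _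
    have hlead : (2 : ℤ) ∣ d k * 3 ^ k :=
      (dvd_add_right hsum).mp (hZ ▸ Dvd.dvd.mul_right (dvd_pow_self 2 hpos.ne') N)
    have hcop : IsCoprime (2 : ℤ) (3 ^ k) := IsCoprime.pow_right (by norm_num)
    have := hcop.dvd_of_dvd_mul_right hlead
    omega
end

section
/- Let d and e be base-3/2 digit strings whose values are natural numbers N and M respectively, and let k be a natural number. If N ≡ M (mod 3^k), then d i = e i for all i < k; that is, the last k digits of base-3/2 representations of integers repeat in a cycle of length 3^k. -/
/-- If the homogenized sum of a string of digits of absolute value less than three is divisible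
by `3 ^ k`, then the first `k` digits vanish. -/
theorem eq_zero_of_three_pow_dvd_sum (k n : ℕ) (hkn : k ≤ n) (c : ℕ → ℤ)
    (hc : ∀ i, |c i| < 3)
    (h : (3 : ℤ) ^ k ∣ ∑ i ∈ Finset.range n, c i * (3 ^ i * 2 ^ (n - i))) :
    ∀ i < k, c i = 0 := by
  induction k generalizing n c with
  | zero => simp
  | succ k ih =>
    obtain ⟨n, rfl⟩ : ∃ m, n = m + 1 := ⟨n - 1, by lia⟩
    have hsplit : ∑ i ∈ Finset.range (n + 1), c i * (3 ^ i * 2 ^ (n + 1 - i)) =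
        3 * ∑ i ∈ Finset.range n, c (i + 1) * (3 ^ i * 2 ^ (n - i)) + c 0 * 2 ^ (n + 1) := by
      rw [Finset.sum_range_succ', Finset.mul_sum]
      congr 1
      · refine Finset.sum_congr rfl fun i _ => ?_
        rw [Nat.add_sub_add_right]
        ring
      · simp
    rw [hsplit, pow_succ'] at h
    have h3 : (3 : ℤ) ∣ c 0 * 2 ^ (n + 1) :=
      (dvd_add_right (dvd_mul_right _ _)).mp ((dvd_mul_right _ _).trans h)
    have hcop : IsCoprime (3 : ℤ) (2 ^ (n + 1)) := IsCoprime.pow_right ⟨1, -1, by norm_num⟩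
    have h0 : c 0 = 0 := Int.eq_zero_of_abs_lt_dvd (hcop.dvd_of_dvd_mul_right h3) (hc 0)
    rw [h0, zero_mul, add_zero] at h
    have htail := ih n (by lia) (fun i => c (i + 1)) (fun i => hc _)
      ((mul_dvd_mul_iff_left three_ne_zero).mp h)
    rintro (_ | i) hi
    · exact h0
    · exact htail i (by lia)

/-- Clearing denominators in the value of a base-3/2 digit string. -/
theorem sum_range_eq_two_pow_mul_of_val32_eq (d : ℕ →₀ ℕ) (N n : ℕ) (h : val32 d = N)
    (hn : d.support ⊆ Finset.range n) :
    ∑ i ∈ Finset.range n, (d i : ℤ) * (3 ^ i * 2 ^ (n - i)) = 2 ^ n * N := by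
  rw [val32, Finsupp.sum_of_support_subset d hn _ (by simp)] at h
  have hQ : ∑ i ∈ Finset.range n, (d i : ℚ) * (3 ^ i * 2 ^ (n - i)) = 2 ^ n * N := by
    rw [← h, Finset.mul_sum]
    refine Finset.sum_congr rfl fun i hi => ?_
    rw [← pow_sub_mul_pow (2 : ℚ) (Finset.mem_range.mp hi).le, div_pow]
    field_simp
  exact_mod_cast hQ

/-- The last `k` digits of base-3/2 representations of integers repeat in a
cycle of length `3^k`: congruent integers mod `3^k` have the same last `k` digits. -/
theorem base32_last_digits_cycle (d e : ℕ →₀ ℕ)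
    (hd : ∀ i, d i ≤ 2) (he : ∀ i, e i ≤ 2)
    (N M : ℕ) (hdN : val32 d = N) (heM : val32 e = M)
    (k : ℕ) (hmod : N ≡ M [MOD 3 ^ k]) :
    ∀ i < k, d i = e i := by
  obtain ⟨m, hm⟩ := (d.support ∪ e.support).exists_nat_subset_range
  have hmn : Finset.range m ⊆ Finset.range (m + k) := Finset.range_mono (by lia)
  have hdvd : (3 : ℤ) ^ k ∣ N - M := by
    exact_mod_cast (Nat.modEq_iff_dvd.mp hmod.symm)
  have key := eq_zero_of_three_pow_dvd_sum k (m + k) (by lia) (fun i => (d i : ℤ) - e i)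
    (fun i => by
      have := hd i
      have := he i
      rw [abs_lt]
      lia)
    (by
      simp only [sub_mul, Finset.sum_sub_distrib]
      rw [sum_range_eq_two_pow_mul_of_val32_eq d N _ hdN
          ((Finset.subset_union_left.trans hm).trans hmn),
        sum_range_eq_two_pow_mul_of_val32_eq e M _ heM
          ((Finset.subset_union_right.trans hm).trans hmn), ← mul_sub]
      exact hdvd.mul_left _)
  intro i hi
  exact_mod_cast sub_eq_zero.mp (key i hi)
end

section
/- If x is a base-3/2 digit string with x j = 2 for some index j, then there exist two-free base-3/2 digit strings a and b such that 2 · v(b) − v(a) = v(x), v(a) < v(b) < v(x), and t(a) < t(b) < t(x); that is, every integer-like number containing a digit 2 forms a three-term arithmetic progression with two smaller two-free numbers, smaller both in base-3/2 value order and in ternary-reading order. -/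
/-- The ternary reading of a digit string. -/
def ter (d : ℕ →₀ ℕ) : ℕ := d.sum fun i c => c * 3 ^ i

/-- A digit string is two-free if all of its digits are 0 or 1. -/
def TwoFree (d : ℕ →₀ ℕ) : Prop := ∀ i, d i ≤ 1

theorem Finsupp.sum_lt_sum_of_strictMono {R : Type*} [AddCommMonoid R] [PartialOrder R]
    [IsOrderedCancelAddMonoid R] {f : ℕ → ℕ → R} (hf₀ : ∀ i, f i 0 = 0)
    (hf : ∀ i, StrictMono (f i)) {d e : ℕ →₀ ℕ} (hde : d < e) :
    d.sum f < e.sum f := by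
  obtain ⟨hle, j, hj⟩ := Finsupp.lt_def.mp hde
  rw [d.sum_of_support_subset (Finsupp.support_mono hle) f fun i _ => hf₀ i]
  exact Finset.sum_lt_sum (fun i _ => (hf i).monotone (hle i))
    ⟨j, Finsupp.mem_support_iff.mpr (by omega), hf j hj⟩

theorem val32_strictMono : StrictMono val32 := fun _ _ hde =>
  Finsupp.sum_lt_sum_of_strictMono (by simp) (fun i _ _ h => by gcongr) hde

theorem ter_strictMono : StrictMono ter := fun _ _ hde =>
  Finsupp.sum_lt_sum_of_strictMono (by simp) (fun i _ _ h => by gcongr) hde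

/-- Every integer-like number containing a digit 2 forms a three-term arithmetic
progression with two smaller two-free numbers, smaller both in base-3/2 value
order and in ternary-reading order. -/
theorem digit_two_gives_AP (x : ℕ →₀ ℕ) (hx : ∀ i, x i ≤ 2)
    (j : ℕ) (hj : x j = 2) :
    ∃ a b : ℕ →₀ ℕ, TwoFree a ∧ TwoFree b ∧
      2 * val32 b - val32 a = val32 x ∧
      val32 a < val32 b ∧ val32 b < val32 x ∧
      ter a < ter b ∧ ter b < ter x := by
  let a : ℕ →₀ ℕ := x.mapRange (· % 2) rfl
  let b : ℕ →₀ ℕ := x.mapRange (min 1) rfl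
  have ha (i : ℕ) : a i = x i % 2 := rfl
  have hb (i : ℕ) : b i = min 1 (x i) := rfl
  have hab : a < b := Finsupp.lt_def.mpr
    ⟨fun i => by have := hx i; rw [ha, hb]; omega, j, by rw [ha, hb]; omega⟩
  have hbx : b < x := Finsupp.lt_def.mpr
    ⟨fun i => by rw [hb]; omega, j, by rw [hb]; omega⟩
  have hsum : b + b = x + a := by
    ext i
    have := hx i
    rw [Finsupp.add_apply, Finsupp.add_apply, ha, hb]
    omega
  have hval := congrArg val32 hsum
  rw [val32_add, val32_add] at hval
  exact ⟨a, b, fun i => by rw [ha]; omega, fun i => by rw [hb]; omega, by linarith,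
    val32_strictMono hab, val32_strictMono hbx, ter_strictMono hab, ter_strictMono hbx⟩
end

section
/- For each natural number k, let S_k = {v(d) + 2k : d a two-free base-3/2 digit string} ⊆ ℚ and V_k = ⋃_{m ≥ k} S_m. Then for every q ∈ V_k with q ∉ S_k, there exist a, b ∈ S_k with a < b < q and a + q = 2b; that is, S_k is the lexicographically first (greedy) 3-free subsequence, in value order, of the set of numbers V_k remaining after S_0, …, S_{k−1} are removed. -/
/-- `S k` is the set of values of two-free base-3/2 digit strings shifted by `2k`. -/
def S (k : ℕ) : Set ℚ := {q | ∃ d : ℕ →₀ ℕ, TwoFree d ∧ q = val32 d + 2 * k}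

/-- `V k` is the union of the sets `S m` for `m ≥ k`. -/
def V (k : ℕ) : Set ℚ := {q | ∃ m, k ≤ m ∧ q ∈ S m}

/-- Replacing the digit at position `i` changes the value by the expected amount. -/
theorem val32_update (e : ℕ →₀ ℕ) (i c : ℕ) :
    val32 (e.update i c) + e i * (3 / 2 : ℚ) ^ i = val32 e + c * (3 / 2 : ℚ) ^ i :=
  Finsupp.sum_update_add e i c (fun i c => (c : ℚ) * (3 / 2 : ℚ) ^ i)
    (by simp) (by intros; push_cast; ring)

theorem update_le_two {e : ℕ →₀ ℕ} (he : ∀ j, e j ≤ 2) (i : ℕ) {c : ℕ} (hc : c ≤ 2) (j : ℕ) :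
    e.update i c j ≤ 2 := by
  rw [Finsupp.update_apply]
  split_ifs
  exacts [hc, he j]

/-- Adding `2` at position `i` can be carried out within the digits `0, 1, 2`,
since a digit `3` carries a `2` to the next position. -/
theorem exists_val32_add_two_mul_pow (n i : ℕ) (e : ℕ →₀ ℕ) (he : ∀ j, e j ≤ 2)
    (hn : ∀ j, i + n ≤ j → e j = 0) :
    ∃ e' : ℕ →₀ ℕ, (∀ j, e' j ≤ 2) ∧ val32 e' = val32 e + 2 * (3 / 2 : ℚ) ^ i := by
  induction n generalizing i e with
  | zero =>
    refine ⟨e.update i 2, update_le_two he i le_rfl, ?_⟩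
    simpa [hn i le_rfl] using val32_update e i 2
  | succ n ih =>
    obtain h0 | ⟨c, hc⟩ : e i = 0 ∨ ∃ c, e i = c + 1 := by
      cases e i <;> simp
    · refine ⟨e.update i 2, update_le_two he i le_rfl, ?_⟩
      simpa [h0] using val32_update e i 2
    · have hi := he i
      obtain ⟨e', he', hv⟩ := ih (i + 1) (e.update i c) (update_le_two he i (by omega))
        fun j hj => by
          rw [Finsupp.update_apply, if_neg (by omega)]
          exact hn j (by omega)
      refine ⟨e', he', ?_⟩
      have hu := val32_update e i c
      rw [hc] at hu
      push_cast at hu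
      rw [hv, pow_succ]
      linarith

/-- Every `val32 d + 2 * n` with `d` having digits at most `2` is again the value of
such a digit string. -/
theorem exists_val32_add_two_mul (d : ℕ →₀ ℕ) (hd : ∀ j, d j ≤ 2) (n : ℕ) :
    ∃ e : ℕ →₀ ℕ, (∀ j, e j ≤ 2) ∧ val32 e = val32 d + 2 * n := by
  induction n with
  | zero => exact ⟨d, hd, by simp⟩
  | succ n ih =>
    obtain ⟨e, he, hv⟩ := ih
    obtain ⟨e', he', hv'⟩ := exists_val32_add_two_mul_pow (e.support.sup id + 1) 0 e he
      fun j hj => by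
        by_contra hne
        have : j ≤ e.support.sup id :=
          Finset.le_sup (f := id) (Finsupp.mem_support_iff.2 hne)
        omega
    refine ⟨e', he', ?_⟩
    rw [hv', hv]
    push_cast
    ring

theorem val32_mapRange (e : ℕ →₀ ℕ) (f : ℕ → ℕ) (hf : f 0 = 0) :
    val32 (e.mapRange f hf) = ∑ i ∈ e.support, (f (e i) : ℚ) * (3 / 2 : ℚ) ^ i :=
  Finsupp.sum_mapRange_index (by simp)

/-- A digit string with digits at most `2`, not two-free, has as value the last term of a
3-term progression of values whose first two terms come from two-free strings. -/
theorem exists_twoFree_progression (e : ℕ →₀ ℕ) (he : ∀ j, e j ≤ 2) (h : ¬ TwoFree e) :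
    ∃ a b : ℕ →₀ ℕ, TwoFree a ∧ TwoFree b ∧ val32 a < val32 b ∧
      val32 a + val32 e = 2 * val32 b := by
  refine ⟨e.mapRange (fun c => if c = 2 then 0 else c) (by simp),
    e.mapRange (fun c => if c = 2 then 1 else c) (by simp), fun i => ?_, fun i => ?_, ?_, ?_⟩
  · have := he i
    simp only [Finsupp.mapRange_apply]
    split_ifs <;> omega
  · have := he i
    simp only [Finsupp.mapRange_apply]
    split_ifs <;> omega
  · rw [val32_mapRange, val32_mapRange]
    obtain ⟨i, hi⟩ := not_forall.1 h
    have hi2 : e i = 2 := by have := he i; omega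
    refine Finset.sum_lt_sum (fun j _ => ?_) ⟨i, by simp [hi2], by simp [hi2]⟩
    gcongr
    split_ifs <;> simp
  · rw [val32_mapRange, val32_mapRange, val32, Finsupp.sum, ← Finset.sum_add_distrib,
      Finset.mul_sum]
    refine Finset.sum_congr rfl fun j _ => ?_
    split_ifs with hj
    · rw [hj]
      push_cast
      ring
    · ring

/-- `S k` is the greedy (lexicographically first, in value order) 3-free
subsequence of the numbers `V k` remaining after `S 0, …, S (k-1)` are removed:
any remaining number outside `S k` completes a 3-term arithmetic progression
with two smaller elements of `S k`. -/
theorem Sk_greedy_three_free (k : ℕ) (q : ℚ) (hq : q ∈ V k) (hq' : q ∉ S k) :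
    ∃ a b : ℚ, a ∈ S k ∧ b ∈ S k ∧ a < b ∧ b < q ∧ a + q = 2 * b := by
  obtain ⟨m, hkm, d, hd, rfl⟩ := hq
  obtain ⟨n, rfl⟩ := Nat.exists_eq_add_of_le hkm
  obtain ⟨e, he, hv⟩ := exists_val32_add_two_mul d (fun j => (hd j).trans one_le_two) n
  have hq : val32 d + 2 * ((k + n : ℕ) : ℚ) = val32 e + 2 * k := by
    rw [hv]
    push_cast
    ring
  rw [hq] at hq' ⊢
  obtain ⟨a, b, ha, hb, hlt, hab⟩ :=
    exists_twoFree_progression e he fun h => hq' ⟨e, h, rfl⟩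
  exact ⟨val32 a + 2 * k, val32 b + 2 * k, ⟨a, ha, rfl⟩, ⟨b, hb, rfl⟩,
    by linarith, by linarith, by linarith⟩
end

section
/- For every natural number k, the set A_k = { t(x) : x a base-3/2 digit string such that v(x) = v(d) + 2k for some two-free base-3/2 digit string d } contains no three-term arithmetic progression of distinct elements: there are no p, q, r ∈ A_k with p < q < r and p + r = 2q. That is, the sequence S_k written in base 3/2 and then interpreted in base 3 is 3-free. -/
/-- `A k` is the set of ternary readings of base-3/2 digit strings whose value
lies in `S k = {v(d) + 2k : d two-free}`. -/
def A (k : ℕ) : Set ℕ :=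
  {p | ∃ x : ℕ →₀ ℕ, (∀ i, x i ≤ 2) ∧
    (∃ d : ℕ →₀ ℕ, TwoFree d ∧ val32 x = val32 d + 2 * k) ∧ ter x = p}

theorem val32_add_s16 (a b : ℕ →₀ ℕ) : val32 (a + b) = val32 a + val32 b :=
  Finsupp.sum_add_index' (by simp) (by intros; push_cast; ring)

theorem ter_add (a b : ℕ →₀ ℕ) : ter (a + b) = ter a + ter b :=
  Finsupp.sum_add_index' (by simp) (by intros; ring)

theorem ter_single (i c : ℕ) : ter (Finsupp.single i c) = c * 3 ^ i :=
  Finsupp.sum_single_index (by simp)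

/-- The digit string with its lowest digit removed. -/
noncomputable def digitTail (d : ℕ →₀ ℕ) : ℕ →₀ ℕ :=
  d.comapDomain Nat.succ Nat.succ_injective.injOn

theorem digitTail_apply (d : ℕ →₀ ℕ) (i : ℕ) : digitTail d i = d (i + 1) := rfl

theorem digitTail_add (a b : ℕ →₀ ℕ) : digitTail (a + b) = digitTail a + digitTail b := by
  ext i
  simp [digitTail_apply]

theorem digitTail_single_zero (c : ℕ) : digitTail (Finsupp.single 0 c) = 0 := by
  ext i
  simp [digitTail_apply]

theorem digitTail_single_succ (i c : ℕ) :
    digitTail (Finsupp.single (i + 1) c) = Finsupp.single i c := by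
  ext j
  simp [digitTail_apply, Finsupp.single_apply]

theorem val32_eq_head_add_tail (d : ℕ →₀ ℕ) :
    val32 d = d 0 + 3 / 2 * val32 (digitTail d) := by
  induction d using Finsupp.induction_linear with
  | zero => simp [val32, digitTail]
  | add a b ha hb =>
    rw [digitTail_add, val32_add_s16, val32_add_s16, ha, hb, Finsupp.add_apply]
    push_cast
    ring
  | single i c =>
    cases i with
    | zero => rw [digitTail_single_zero, val32_single]; simp [val32]
    | succ i => rw [digitTail_single_succ, val32_single, val32_single]; simp; ring

theorem ter_eq_head_add_tail (d : ℕ →₀ ℕ) : ter d = d 0 + 3 * ter (digitTail d) := by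
  induction d using Finsupp.induction_linear with
  | zero => simp [ter, digitTail]
  | add a b ha hb =>
    rw [digitTail_add, ter_add, ter_add, ha, hb, Finsupp.add_apply]
    ring
  | single i c =>
    cases i with
    | zero => rw [digitTail_single_zero, ter_single]; simp [ter]
    | succ i => rw [digitTail_single_succ, ter_single, ter_single]; simp; ring

theorem exists_two_pow_mul_val32 (d : ℕ →₀ ℕ) : ∃ n m : ℕ, 2 ^ n * val32 d = m := by
  induction d using Finsupp.induction_linear with
  | zero => exact ⟨0, 0, by simp [val32]⟩
  | add a b ha hb =>
    obtain ⟨n, m, h⟩ := ha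
    obtain ⟨n', m', h'⟩ := hb
    refine ⟨n + n', 2 ^ n' * m + 2 ^ n * m', ?_⟩
    rw [val32_add_s16]
    push_cast
    rw [← h, ← h']
    ring
  | single i c =>
    refine ⟨i, c * 3 ^ i, ?_⟩
    rw [val32_single, div_pow]
    push_cast
    field_simp

/-- Adding `2 * k` to a two-free digit string is a transducer whose state is the carry:
reading the digit `e` it outputs `(e + 2 * k) % 3` and passes on the carry `(e + 2 * k) / 3`. -/
theorem exists_digit_of_mem_A {k p : ℕ} (hp : p ∈ A k) :
    ∃ e ≤ 1, ∃ p' ∈ A ((e + 2 * k) / 3), p = (e + 2 * k) % 3 + 3 * p' := by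
  obtain ⟨x, hx, ⟨d, hd, hv⟩, rfl⟩ := hp
  rw [val32_eq_head_add_tail x, val32_eq_head_add_tail d] at hv
  have hmod : x 0 = (d 0 + 2 * k) % 3 := by
    obtain ⟨n, m, h⟩ := exists_two_pow_mul_val32 (digitTail x)
    obtain ⟨n', m', h'⟩ := exists_two_pow_mul_val32 (digitTail d)
    have key : (2 ^ (n + n' + 1) * ((x 0 : ℤ) - (d 0 + 2 * k)) : ℤ) =
        3 * (2 ^ n * m' - 2 ^ n' * m) := by
      have : (2 ^ (n + n' + 1) * ((x 0 : ℚ) - (d 0 + 2 * k)) : ℚ) =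
          3 * (2 ^ n * m' - 2 ^ n' * m) := by
        rw [← h, ← h', pow_succ, pow_add]
        linear_combination 2 ^ n * 2 ^ n' * 2 * hv
      exact_mod_cast this
    have hcop : IsCoprime (3 : ℤ) (2 ^ (n + n' + 1)) :=
      IsCoprime.pow_right (by norm_num)
    have := hcop.dvd_of_dvd_mul_left ⟨_, key⟩
    have := hx 0
    omega
  refine ⟨d 0, hd 0, ter (digitTail x), ⟨digitTail x, fun i => hx (i + 1),
    ⟨digitTail d, fun i => hd (i + 1), ?_⟩, rfl⟩, ?_⟩
  · have hdiv : (x 0 : ℚ) + 3 * ((d 0 + 2 * k) / 3 : ℕ) = d 0 + 2 * k := by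
      rw [hmod]
      exact_mod_cast Nat.mod_add_div (d 0 + 2 * k) 3
    linear_combination 2 / 3 * hv - 2 / 3 * hdiv
  · rw [ter_eq_head_add_tail, hmod]

/-- The sequence `S k` written in base 3/2 and then interpreted in base 3 is
3-free: `A k` contains no three-term arithmetic progression of distinct elements. -/
theorem Ak_three_free (k : ℕ) :
    ¬ ∃ p q r : ℕ, p ∈ A k ∧ q ∈ A k ∧ r ∈ A k ∧ p < q ∧ q < r ∧ p + r = 2 * q := by
  rintro ⟨p, q, r, hp, hq, hr, hpq, hqr, h⟩
  induction q using Nat.strong_induction_on generalizing k p r with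
  | _ q ih =>
    obtain ⟨a, ha, p', hp', rfl⟩ := exists_digit_of_mem_A hp
    obtain ⟨b, hb, q', hq', rfl⟩ := exists_digit_of_mem_A hq
    obtain ⟨c, hc, r', hr', rfl⟩ := exists_digit_of_mem_A hr
    obtain ⟨rfl, rfl⟩ : a = b ∧ a = c := by
      clear ih hp hq hr hp' hq' hr'
      interval_cases a <;> interval_cases b <;> interval_cases c <;> omega
    exact ih q' (by omega) _ p' r' hp' hq' hr' (by omega) (by omega) (by omega)
end
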